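/- Let H be a quasi-bialgebra over k and A an H-bimodule algebra, and define J(h⊗φ) = h₁·φ ⊗ h₂, T(φ⊗h) = φ·h₂ ⊗ h₁, γ(φ⊗φ') = φ·z³ ⊗ z¹·φ' ⊗ z², η(φ⊗φ') = (x¹·φ·y²)(x²·φ'·y³) ⊗ x³ ⊗ y¹ (x, y, z copies of Φ⁻¹). Then the L-R-crossed product multiplication on A⊗H built from these maps equals the L-R-smash product multiplication: (φ⊗h)(φ'⊗h') = (x¹·φ·z³h'₂y²)(x²h₁z¹·φ'·y³) ⊗ x³h₂z²h'₁y¹ for all φ, φ' ∈ A and h, h' ∈ H. -/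

import Mathlib

open TensorProduct LinearMap

noncomputable section

variable {k : Type*} [Field k]

section Helpers

variable {M N P Q : Type*}
  [AddCommMonoid M] [AddCommMonoid N] [AddCommMonoid P] [AddCommMonoid Q]
  [Module k M] [Module k N] [Module k P] [Module k Q]

def aso : (M ⊗[k] N) ⊗[k] P →ₗ[k] M ⊗[k] (N ⊗[k] P) :=
  (TensorProduct.assoc k M N P).toLinearMap

def osa : M ⊗[k] (N ⊗[k] P) →ₗ[k] (M ⊗[k] N) ⊗[k] P :=
  (TensorProduct.assoc k M N P).symm.toLinearMap

def cc : M ⊗[k] N →ₗ[k] N ⊗[k] M := (TensorProduct.comm k M N).toLinearMap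

def lc : M ⊗[k] (N ⊗[k] P) →ₗ[k] N ⊗[k] (M ⊗[k] P) :=
  (TensorProduct.leftComm k M N P).toLinearMap

def tt : (M ⊗[k] N) ⊗[k] (P ⊗[k] Q) →ₗ[k] (M ⊗[k] P) ⊗[k] (N ⊗[k] Q) :=
  (TensorProduct.tensorTensorTensorComm k M N P Q).toLinearMap

end Helpers

section LRCrossed

variable (k)
variable (H U : Type*) [Ring H] [Algebra k H] [AddCommGroup U] [Module k U]

abbrev mH : H ⊗[k] H →ₗ[k] H := LinearMap.mul' k H

def dR : (H ⊗[k] H) ⊗[k] H →ₗ[k] H ⊗[k] H :=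
  rTensor H (mH k H) ∘ₗ osa ∘ₗ lTensor H cc ∘ₗ aso

/-- `d ⊗ (g ⊗ i) ↦ (d*g) ⊗ i`. -/
def dL : H ⊗[k] (H ⊗[k] H) →ₗ[k] H ⊗[k] H :=
  rTensor H (mH k H) ∘ₗ osa

/-- `(g ⊗ i) ⊗ d ↦ g ⊗ (d*i)`. -/
def eR : (H ⊗[k] H) ⊗[k] H →ₗ[k] H ⊗[k] H :=
  lTensor H ((mH k H) ∘ₗ cc) ∘ₗ aso

/-- `d ⊗ (g ⊗ i) ↦ g ⊗ (i*d)`. -/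
def eL : H ⊗[k] (H ⊗[k] H) →ₗ[k] H ⊗[k] H :=
  lTensor H ((mH k H) ∘ₗ cc) ∘ₗ lc

/-- `(g ⊗ i) ⊗ (a ⊗ b) ↦ (g*a) ⊗ (b*i)`. -/
def mulLR : (H ⊗[k] H) ⊗[k] (H ⊗[k] H) →ₗ[k] H ⊗[k] H :=
  TensorProduct.map (mH k H) ((mH k H) ∘ₗ cc) ∘ₗ tt


def w12 : H ⊗[k] (H ⊗[k] H) →ₗ[k] H ⊗[k] H :=
  lTensor H ((mH k H) ∘ₗ cc) ∘ₗ lc ∘ₗ lTensor H cc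

def inner12 : (H ⊗[k] H) ⊗[k] (H ⊗[k] H) →ₗ[k] H ⊗[k] H :=
  lTensor H ((mH k H) ∘ₗ cc) ∘ₗ aso ∘ₗ lTensor (H ⊗[k] H) ((mH k H) ∘ₗ cc)

/-- `(g ⊗ i) ⊗ (b ⊗ (d ⊗ e)) ↦ g * d * e * b * i`. -/
def omegaM : (H ⊗[k] H) ⊗[k] (H ⊗[k] (H ⊗[k] H)) →ₗ[k] H :=
  (mH k H) ∘ₗ
    TensorProduct.map (mH k H) ((mH k H) ∘ₗ rTensor H (mH k H) ∘ₗ cc) ∘ₗ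
    tt ∘ₗ lTensor (H ⊗[k] H) (lTensor H cc ∘ₗ lc)

variable {H U}
variable (J : H ⊗[k] U →ₗ[k] U ⊗[k] H) (T : U ⊗[k] H →ₗ[k] U ⊗[k] H)
variable (γ : U ⊗[k] U →ₗ[k] U ⊗[k] (U ⊗[k] H))
variable (η : U ⊗[k] U →ₗ[k] U ⊗[k] (H ⊗[k] H))

variable (oneU : U)

/-- Axiom (1): `J(h ⊗ 1_U) = 1_U ⊗ h` and `J(1_H ⊗ u) = u ⊗ 1_H`. -/
def LRax1 : Prop :=
  (∀ h : H, J (h ⊗ₜ oneU) = oneU ⊗ₜ h) ∧ (∀ u : U, J ((1 : H) ⊗ₜ u) = u ⊗ₜ (1 : H))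

/-- Axiom (2): `T(u ⊗ 1_H) = u ⊗ 1_H` and `T(1_U ⊗ h) = 1_U ⊗ h`. -/
def LRax2 : Prop :=
  (∀ u : U, T (u ⊗ₜ (1 : H)) = u ⊗ₜ (1 : H)) ∧ (∀ h : H, T (oneU ⊗ₜ h) = oneU ⊗ₜ h)

/-- Axiom (3): `γ(u ⊗ 1_U) = u ⊗ 1_U ⊗ 1_H` and `γ(1_U ⊗ u) = 1_U ⊗ u ⊗ 1_H`. -/
def LRax3 : Prop :=
  (∀ u : U, γ (u ⊗ₜ oneU) = u ⊗ₜ (oneU ⊗ₜ (1 : H))) ∧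
  (∀ u : U, γ (oneU ⊗ₜ u) = oneU ⊗ₜ (u ⊗ₜ (1 : H)))

/-- Axiom (4): `η(u ⊗ 1_U) = η(1_U ⊗ u) = u ⊗ 1_H ⊗ 1_H`. -/
def LRax4 : Prop :=
  (∀ u : U, η (u ⊗ₜ oneU) = u ⊗ₜ ((1 : H) ⊗ₜ (1 : H))) ∧
  (∀ u : U, η (oneU ⊗ₜ u) = u ⊗ₜ ((1 : H) ⊗ₜ (1 : H)))

/-- Axiom (5): `u_J ⊗ (hh')_J = (u_J)_j ⊗ h_j h'_J`. -/
def LRax5 : Prop := ∀ (h h' : H) (u : U),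
  J ((h * h') ⊗ₜ u) =
    lTensor U (mH k H) (aso (rTensor H J (osa (h ⊗ₜ (J (h' ⊗ₜ u))))))

/-- Axiom (6): `u_T ⊗ (hh')_T = (u_T)_t ⊗ h_T h'_t`. -/
def LRax6 : Prop := ∀ (u : U) (h h' : H),
  T (u ⊗ₜ (h * h')) =
    lTensor U ((mH k H) ∘ₗ cc)
      (aso (rTensor H T (osa (lTensor U cc (aso ((T (u ⊗ₜ h)) ⊗ₜ h'))))))

/-- Axiom (7):
`η₁(u_J,u'_j) ⊗ η₂(u_J,u'_j)(h_J)_j ⊗ η₃(u_J,u'_j) = η₁(u,u')_J ⊗ h_J η₂(u,u') ⊗ η₃(u,u')`. -/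
def LRax7 : Prop := ∀ (h : H) (u u' : U),
  lTensor U (dR k H)
      (aso (rTensor H η (osa (lTensor U J (aso ((J (h ⊗ₜ u)) ⊗ₜ u'))))))
  = lTensor U (dL k H)
      (aso (rTensor (H ⊗[k] H) J (osa (h ⊗ₜ (η (u ⊗ₜ u'))))))

/-- Axiom (8):
`η₁(u_t,u'_T) ⊗ η₂(u_t,u'_T) ⊗ (h_T)_t η₃(u_t,u'_T) = η₁(u,u')_T ⊗ η₂(u,u') ⊗ η₃(u,u')h_T`. -/
def LRax8 : Prop := ∀ (u u' : U) (h : H),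
  lTensor U (eR k H)
      (aso (rTensor H η (osa (lTensor U cc
        (aso (rTensor U T (osa (lTensor U cc (u ⊗ₜ (T (u' ⊗ₜ h)))))))))))
  = lTensor U (eL k H)
      (aso (rTensor (H ⊗[k] H) T (osa (lTensor U cc (aso ((η (u ⊗ₜ u')) ⊗ₜ h))))))

/-- Axiom (9). -/
def LRax9 : Prop := ∀ (u u' u'' : U),
  lTensor U (mulLR k H)
      (aso (rTensor (H ⊗[k] H) η (osa (lTensor U (aso (P := H))
        ((lTensor U (rTensor H J ∘ₗ osa ∘ₗ lTensor H cc ∘ₗ aso))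
          (aso ((η (u ⊗ₜ u')) ⊗ₜ u'')))))))
  = lTensor U ((mulLR k H) ∘ₗ lTensor (H ⊗[k] H) cc)
      (aso (rTensor (H ⊗[k] H) η (tt (rTensor (U ⊗[k] H) T
        (osa (lTensor U (lc ∘ₗ lTensor U cc) (u ⊗ₜ (η (u' ⊗ₜ u'')))))))))


def qJ : (U ⊗[k] H) ⊗[k] H →ₗ[k] U ⊗[k] H :=
  lTensor U (mH k H) ∘ₗ aso ∘ₗ rTensor H J ∘ₗ osa ∘ₗ lc ∘ₗ lTensor U cc ∘ₗ aso

/-- Axiom (10). -/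
def LRax10 : Prop := ∀ (u u' : U) (h : H),
  lTensor U (lTensor U ((mH k H) ∘ₗ cc))
      (aso (tt (rTensor (U ⊗[k] H) T (osa (lTensor U cc
        (aso (rTensor H γ (osa (u ⊗ₜ (J (h ⊗ₜ u')))))))))))
  = lTensor U (qJ k J)
      (aso (rTensor H γ (osa (lTensor U cc (aso ((T (u ⊗ₜ h)) ⊗ₜ u'))))))

def psi11 : (U ⊗[k] H) ⊗[k] (H ⊗[k] H) →ₗ[k] U ⊗[k] (H ⊗[k] H) :=
  lTensor U (rTensor H (mH k H) ∘ₗ osa) ∘ₗ aso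

def chainX : (U ⊗[k] H) ⊗[k] (U ⊗[k] H) →ₗ[k] U ⊗[k] (H ⊗[k] H) :=
  (lTensor U ((dR k H) ∘ₗ lTensor (H ⊗[k] H) (mH k H))) ∘ₗ aso ∘ₗ
    rTensor (H ⊗[k] H) η ∘ₗ rTensor (H ⊗[k] H) cc ∘ₗ tt ∘ₗ
    lTensor (U ⊗[k] H) cc ∘ₗ rTensor (H ⊗[k] U) J ∘ₗ rTensor (H ⊗[k] U) cc ∘ₗ
    tt ∘ₗ lTensor (U ⊗[k] H) cc

/-- Axiom (11). -/
def LRax11 : Prop := ∀ (u u' u'' : U),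
  lTensor U (psi11 k)
      (aso (tt (rTensor ((U ⊗[k] H) ⊗[k] H) T (tt (rTensor (H ⊗[k] H) γ
        (osa (u ⊗ₜ (η (u' ⊗ₜ u'')))))))))
  = lTensor U (chainX k J η)
      (aso (rTensor (U ⊗[k] H) γ (osa (lTensor U cc
        (aso ((γ (u ⊗ₜ u')) ⊗ₜ u''))))))

def chain12 : (U ⊗[k] H) ⊗[k] (H ⊗[k] H) →ₗ[k] U ⊗[k] (H ⊗[k] H) :=
  (lTensor U (w12 k H)) ∘ₗ aso ∘ₗ tt ∘ₗ rTensor (H ⊗[k] H) J ∘ₗ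
    rTensor (H ⊗[k] H) cc ∘ₗ tt ∘ₗ lTensor (U ⊗[k] H) cc

def big12 : (H ⊗[k] H) ⊗[k] (H ⊗[k] (U ⊗[k] H)) →ₗ[k] U ⊗[k] (H ⊗[k] H) :=
  lTensor U (inner12 k H) ∘ₗ lc ∘ₗ lTensor (H ⊗[k] H) lc

/-- Axiom (12). -/
def LRax12 : Prop := ∀ (u u' u'' : U),
  lTensor U (chain12 k J)
      (aso (rTensor (H ⊗[k] H) γ (osa (lTensor U cc
        (aso ((η (u ⊗ₜ u')) ⊗ₜ u''))))))
  = lTensor U (big12 k)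
      (aso (rTensor (H ⊗[k] (U ⊗[k] H)) η (tt (lTensor (U ⊗[k] H) cc
        (rTensor ((U ⊗[k] H) ⊗[k] U) T (tt (lTensor (U ⊗[k] (U ⊗[k] H)) cc
          (rTensor (U ⊗[k] H) γ (osa (lTensor U lc (u ⊗ₜ (γ (u' ⊗ₜ u'')))))))))))))

def w13 : H ⊗[k] (U ⊗[k] H) →ₗ[k] U ⊗[k] H :=
  lTensor U ((mH k H) ∘ₗ cc) ∘ₗ lc

def xi2 : H ⊗[k] (U ⊗[k] H) →ₗ[k] U ⊗[k] H :=
  lTensor U (mH k H) ∘ₗ aso ∘ₗ rTensor H J ∘ₗ osa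

def xi : H ⊗[k] (U ⊗[k] (U ⊗[k] H)) →ₗ[k] U ⊗[k] (U ⊗[k] H) :=
  lTensor U (xi2 k J) ∘ₗ lc

def rho : (U ⊗[k] H) ⊗[k] U →ₗ[k] (U ⊗[k] (U ⊗[k] H)) ⊗[k] H :=
  rTensor H γ ∘ₗ osa ∘ₗ lTensor U cc ∘ₗ aso

def chainR : ((U ⊗[k] (U ⊗[k] H)) ⊗[k] H) ⊗[k] H →ₗ[k] (U ⊗[k] H) ⊗[k] (U ⊗[k] H) :=
  tt ∘ₗ lTensor (U ⊗[k] U) cc ∘ₗ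
    lTensor (U ⊗[k] U) (rTensor H ((mH k H) ∘ₗ cc) ∘ₗ osa) ∘ₗ tt ∘ₗ
    lTensor (U ⊗[k] H) aso ∘ₗ rTensor ((U ⊗[k] H) ⊗[k] H) T ∘ₗ tt ∘ₗ
    lTensor (U ⊗[k] (U ⊗[k] H)) cc ∘ₗ aso

/-- The composite computing the right-hand side of axiom (13). -/
def rhs13 : ((H ⊗[k] (U ⊗[k] U)) ⊗[k] U) ⊗[k] H →ₗ[k]
    (U ⊗[k] (U ⊗[k] H)) ⊗[k] (U ⊗[k] H) :=
  osa ∘ₗ lTensor U (chainR k T) ∘ₗ aso ∘ₗ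
    rTensor H (lTensor U (rho k γ) ∘ₗ aso ∘ₗ rTensor U ((xi k J) ∘ₗ lTensor H γ))

/-- Axiom (13). -/
def LRax13 : Prop := ∀ (u u' u'' : U) (h h' : H),
  rTensor (U ⊗[k] H) (xi k J)
      (osa (h' ⊗ₜ (lTensor (U ⊗[k] (U ⊗[k] H)) (w13 k)
        (aso (rTensor (U ⊗[k] H) (rTensor H γ) (rTensor (U ⊗[k] H) osa
          (osa (u ⊗ₜ (rTensor (U ⊗[k] H) T (osa (lTensor U cc
            (aso ((γ (u' ⊗ₜ u'')) ⊗ₜ h)))))))))))))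
  = rhs13 k J T γ (((h' ⊗ₜ (u ⊗ₜ u')) ⊗ₜ u'') ⊗ₜ h)

/-- The L-R-crossed product multiplication, as a linear map. -/
def lrM : (U ⊗[k] H) ⊗[k] (U ⊗[k] H) →ₗ[k] U ⊗[k] H :=
  lTensor U (omegaM k H) ∘ₗ aso ∘ₗ rTensor (H ⊗[k] (H ⊗[k] H)) η ∘ₗ tt ∘ₗ
    lTensor (U ⊗[k] H) aso ∘ₗ rTensor ((U ⊗[k] H) ⊗[k] H) T ∘ₗ tt ∘ₗ
    lTensor (U ⊗[k] (U ⊗[k] H)) cc ∘ₗ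
    rTensor (H ⊗[k] H) (lTensor U J ∘ₗ lTensor U cc ∘ₗ aso) ∘ₗ tt ∘ₗ
    rTensor (H ⊗[k] H) (osa ∘ₗ γ) ∘ₗ tt

/-- The L-R-crossed product multiplication of two elements of `U ⊗ H`. -/
def lrMul (x y : U ⊗[k] H) : U ⊗[k] H := lrM k J T γ η (x ⊗ₜ y)

end LRCrossed


section QuasiBialgebra

variable {k : Type*} [Field k]
variable {H : Type*} [Ring H] [Algebra k H]
variable {A : Type*} [AddCommGroup A] [Module k A]

/-- The axioms making `(H, Δ, ε, Φ)` a quasi-bialgebra, where `Φinv` is a two-sided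
inverse of the associator `Φ ∈ H ⊗ H ⊗ H`. -/
structure IsQuasiBialgebra (Δ : H →ₐ[k] H ⊗[k] H) (ε : H →ₐ[k] k)
    (Φ Φinv : (H ⊗[k] H) ⊗[k] H) : Prop where
  coassoc : ∀ h : H,
    osa (lTensor H Δ.toLinearMap (Δ.toLinearMap h)) =
      Φ * (rTensor H Δ.toLinearMap (Δ.toLinearMap h)) * Φinv
  pentagon :
    (osa (lTensor (H ⊗[k] H) Δ.toLinearMap Φ)) *
        (rTensor H (rTensor H Δ.toLinearMap) Φ) =
      (rTensor H (rTensor H (TensorProduct.mk k H H (1 : H))) Φ) *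
        (rTensor H ((osa : H ⊗[k] (H ⊗[k] H) →ₗ[k] (H ⊗[k] H) ⊗[k] H) ∘ₗ
          lTensor H Δ.toLinearMap) Φ) *
        (((TensorProduct.mk k ((H ⊗[k] H) ⊗[k] H) H).flip (1 : H)) Φ)
  counit_left : ∀ h : H, TensorProduct.lid k H (rTensor H ε.toLinearMap (Δ.toLinearMap h)) = h
  counit_right : ∀ h : H, TensorProduct.rid k H (lTensor H ε.toLinearMap (Δ.toLinearMap h)) = h
  counit_phi :
    rTensor H (TensorProduct.rid k H).toLinearMap (rTensor H (lTensor H ε.toLinearMap) Φ) =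
      (1 : H) ⊗ₜ (1 : H)
  phi_inv : Φ * Φinv = 1
  inv_phi : Φinv * Φ = 1

variable (actL : H ⊗[k] A →ₗ[k] A) (actR : A ⊗[k] H →ₗ[k] A)

/-- `X ⊗ (φ ⊗ x) ↦ (X · φ) · x`. -/
def biact : H ⊗[k] (A ⊗[k] H) →ₗ[k] A := actR ∘ₗ rTensor H actL ∘ₗ osa

/-- `(X ⊗ y) ⊗ φ ↦ (X · φ) · y`. -/
def triAct : (H ⊗[k] H) ⊗[k] A →ₗ[k] A :=
  actR ∘ₗ rTensor H actL ∘ₗ osa ∘ₗ lTensor H cc ∘ₗ aso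

/-- Zipping two triples: `((x₁⊗x₂)⊗x₃) ⊗ ((y₁⊗y₂)⊗y₃) ↦ ((x₁⊗y₁)⊗(x₂⊗y₂))⊗(x₃⊗y₃)`. -/
def zip3 {M N : Type*} [AddCommMonoid M] [AddCommMonoid N] [Module k M] [Module k N] :
    ((M ⊗[k] M) ⊗[k] M) ⊗[k] ((N ⊗[k] N) ⊗[k] N) →ₗ[k]
      ((M ⊗[k] N) ⊗[k] (M ⊗[k] N)) ⊗[k] (M ⊗[k] N) :=
  rTensor (M ⊗[k] N) tt ∘ₗ tt

variable (mulA : A ⊗[k] A →ₗ[k] A)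

/-- `Φ ⊗ (Φ⁻¹ ⊗ ((φ⊗φ')⊗φ'')) ↦ (X¹·φ·x¹)((X²·φ'·x²)(X³·φ''·x³))`. -/
def quasiAct : ((H ⊗[k] H) ⊗[k] H) ⊗[k]
    (((H ⊗[k] H) ⊗[k] H) ⊗[k] ((A ⊗[k] A) ⊗[k] A)) →ₗ[k] A :=
  mulA ∘ₗ lTensor A mulA ∘ₗ aso ∘ₗ
    TensorProduct.map (TensorProduct.map (biact actL actR) (biact actL actR))
      (biact actL actR) ∘ₗ
    zip3 ∘ₗ lTensor ((H ⊗[k] H) ⊗[k] H) (zip3 ∘ₗ cc)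

/-- The `H`-bimodule algebra axioms for `A` over the quasi-bialgebra `(H, Δ, ε, Φ)`. -/
structure IsBimoduleAlgebra (Δ : H →ₐ[k] H ⊗[k] H) (ε : H →ₐ[k] k)
    (Φ Φinv : (H ⊗[k] H) ⊗[k] H) (oneA : A) : Prop where
  actL_actL : ∀ (h h' : H) (φ : A), actL (h ⊗ₜ actL (h' ⊗ₜ φ)) = actL ((h * h') ⊗ₜ φ)
  one_actL : ∀ φ : A, actL ((1 : H) ⊗ₜ φ) = φ
  actR_actR : ∀ (φ : A) (h h' : H), actR (actR (φ ⊗ₜ h) ⊗ₜ h') = actR (φ ⊗ₜ (h * h'))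
  actR_one : ∀ φ : A, actR (φ ⊗ₜ (1 : H)) = φ
  actL_actR : ∀ (h : H) (φ : A) (h' : H),
    actR (actL (h ⊗ₜ φ) ⊗ₜ h') = actL (h ⊗ₜ actR (φ ⊗ₜ h'))
  actL_mulA : ∀ (h : H) (φ φ' : A),
    actL (h ⊗ₜ mulA (φ ⊗ₜ φ')) =
      mulA (TensorProduct.map actL actL (tt ((Δ.toLinearMap h) ⊗ₜ (φ ⊗ₜ φ'))))
  actR_mulA : ∀ (h : H) (φ φ' : A),
    actR (mulA (φ ⊗ₜ φ') ⊗ₜ h) =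
      mulA (TensorProduct.map actR actR (tt ((φ ⊗ₜ φ') ⊗ₜ (Δ.toLinearMap h))))
  actL_one : ∀ h : H, actL (h ⊗ₜ oneA) = ε h • oneA
  one_actR : ∀ h : H, actR (oneA ⊗ₜ h) = ε h • oneA
  mulA_one : ∀ φ : A, mulA (φ ⊗ₜ oneA) = φ
  one_mulA : ∀ φ : A, mulA (oneA ⊗ₜ φ) = φ
  quasi_assoc : ∀ φ φ' φ'' : A,
    mulA (mulA (φ ⊗ₜ φ') ⊗ₜ φ'') =
      quasiAct actL actR mulA (Φ ⊗ₜ (Φinv ⊗ₜ ((φ ⊗ₜ φ') ⊗ₜ φ'')))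

variable (Δ : H →ₐ[k] H ⊗[k] H) (Φinv : (H ⊗[k] H) ⊗[k] H)

/-- `J(h ⊗ φ) = h₁·φ ⊗ h₂`. -/
def smashJ : H ⊗[k] A →ₗ[k] A ⊗[k] H :=
  rTensor H actL ∘ₗ osa ∘ₗ lTensor H cc ∘ₗ aso ∘ₗ rTensor A Δ.toLinearMap

/-- `T(φ ⊗ h) = φ·h₂ ⊗ h₁`. -/
def smashT : A ⊗[k] H →ₗ[k] A ⊗[k] H :=
  rTensor H actR ∘ₗ osa ∘ₗ lTensor A cc ∘ₗ lTensor A Δ.toLinearMap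

/-- `((z¹⊗z²)⊗z³) ⊗ (φ⊗φ') ↦ (φ·z³) ⊗ ((z¹·φ') ⊗ z²)`. -/
def smashΓ : ((H ⊗[k] H) ⊗[k] H) ⊗[k] (A ⊗[k] A) →ₗ[k] A ⊗[k] (A ⊗[k] H) :=
  lc ∘ₗ
    lTensor A (cc ∘ₗ lTensor H (actR ∘ₗ cc) ∘ₗ aso) ∘ₗ
    rTensor ((H ⊗[k] H) ⊗[k] A) actL ∘ₗ tt ∘ₗ
    lTensor (H ⊗[k] (H ⊗[k] H)) cc ∘ₗ rTensor (A ⊗[k] A) aso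

/-- `γ(φ ⊗ φ') = φ·z³ ⊗ z¹·φ' ⊗ z²` with `z = Φ⁻¹`. -/
def smashγ : A ⊗[k] A →ₗ[k] A ⊗[k] (A ⊗[k] H) :=
  smashΓ actL actR ∘ₗ TensorProduct.mk k ((H ⊗[k] H) ⊗[k] H) (A ⊗[k] A) Φinv

/-- Reordering and zipping two copies of `Φ⁻¹`:
`((x¹⊗x²)⊗x³) ⊗ ((y¹⊗y²)⊗y³) ↦ ((x¹⊗y²)⊗(x²⊗y³))⊗(x³⊗y¹)`. -/
def smashΞ : ((H ⊗[k] H) ⊗[k] H) ⊗[k] ((H ⊗[k] H) ⊗[k] H) →ₗ[k]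
    ((H ⊗[k] H) ⊗[k] (H ⊗[k] H)) ⊗[k] (H ⊗[k] H) :=
  rTensor (H ⊗[k] H) tt ∘ₗ tt ∘ₗ lTensor ((H ⊗[k] H) ⊗[k] H) (cc ∘ₗ aso)

/-- `((x²⊗y³)⊗(x³⊗y¹)) ⊗ φ' ↦ (x²·φ'·y³) ⊗ (x³⊗y¹)`. -/
def smashSec : (((H ⊗[k] H) ⊗[k] (H ⊗[k] H)) ⊗[k] A) →ₗ[k] A ⊗[k] (H ⊗[k] H) :=
  rTensor (H ⊗[k] H) (triAct actL actR) ∘ₗ osa ∘ₗ lTensor (H ⊗[k] H) cc ∘ₗ aso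

/-- `(Φ⁻¹ ⊗ Φ⁻¹) ⊗ (φ⊗φ') ↦ (x¹·φ·y²)(x²·φ'·y³) ⊗ (x³ ⊗ y¹)`. -/
def smashΛ : (((H ⊗[k] H) ⊗[k] H) ⊗[k] ((H ⊗[k] H) ⊗[k] H)) ⊗[k] (A ⊗[k] A) →ₗ[k]
    A ⊗[k] (H ⊗[k] H) :=
  rTensor (H ⊗[k] H) mulA ∘ₗ osa ∘ₗ
    TensorProduct.map (triAct actL actR) (smashSec actL actR) ∘ₗ tt ∘ₗ
    rTensor (A ⊗[k] A) aso ∘ₗ rTensor (A ⊗[k] A) smashΞ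

/-- `η(φ ⊗ φ') = (x¹·φ·y²)(x²·φ'·y³) ⊗ x³ ⊗ y¹` with `x, y` copies of `Φ⁻¹`. -/
def smashη : A ⊗[k] A →ₗ[k] A ⊗[k] (H ⊗[k] H) :=
  smashΛ actL actR mulA ∘ₗ
    TensorProduct.mk k (((H ⊗[k] H) ⊗[k] H) ⊗[k] ((H ⊗[k] H) ⊗[k] H)) (A ⊗[k] A)
      (Φinv ⊗ₜ Φinv)

end QuasiBialgebra


section SmashRHS

variable {k : Type*} [Field k]
variable {H : Type*} [Ring H] [Algebra k H]
variable {A : Type*} [AddCommGroup A] [Module k A]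
variable (actL : H ⊗[k] A →ₗ[k] A) (actR : A ⊗[k] H →ₗ[k] A)
variable (mulA : A ⊗[k] A →ₗ[k] A)
variable (Δ : H →ₐ[k] H ⊗[k] H) (Φinv : (H ⊗[k] H) ⊗[k] H)

/-- `h'₂ ⊗ ((z³⊗y²) ⊗ G₂) ↦ (z³ ⊗ (h'₂ ⊗ y²)) ⊗ G₂`. -/
def ins1 : H ⊗[k] ((H ⊗[k] H) ⊗[k] (H ⊗[k] H)) →ₗ[k]
    (H ⊗[k] (H ⊗[k] H)) ⊗[k] (H ⊗[k] H) :=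
  rTensor (H ⊗[k] H) lc ∘ₗ osa

/-- `h₁ ⊗ (K₁ ⊗ (z¹⊗y³)) ↦ K₁ ⊗ ((h₁⊗z¹) ⊗ y³)`. -/
def ins2 : H ⊗[k] ((H ⊗[k] (H ⊗[k] H)) ⊗[k] (H ⊗[k] H)) →ₗ[k]
    (H ⊗[k] (H ⊗[k] H)) ⊗[k] ((H ⊗[k] H) ⊗[k] H) :=
  lTensor (H ⊗[k] (H ⊗[k] H)) osa ∘ₗ lc

/-- `(x¹ ⊗ (z³ ⊗ (h'₂ ⊗ y²))) ⊗ φ ↦ x¹·φ·(z³h'₂y²)`. -/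
def smashL : (H ⊗[k] (H ⊗[k] (H ⊗[k] H))) ⊗[k] A →ₗ[k] A :=
  triAct actL actR ∘ₗ
    rTensor A (lTensor H ((LinearMap.mul' k H) ∘ₗ lTensor H (LinearMap.mul' k H)))

/-- `(x² ⊗ ((h₁ ⊗ z¹) ⊗ y³)) ⊗ φ' ↦ (x²h₁z¹)·φ'·y³`. -/
def smashR : (H ⊗[k] ((H ⊗[k] H) ⊗[k] H)) ⊗[k] A →ₗ[k] A :=
  triAct actL actR ∘ₗ
    rTensor A (rTensor H ((LinearMap.mul' k H) ∘ₗ lTensor H (LinearMap.mul' k H)) ∘ₗ osa)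

/-- `x³ ⊗ (h₂ ⊗ (z² ⊗ (h'₁ ⊗ y¹))) ↦ x³h₂z²h'₁y¹`. -/
def smashF : H ⊗[k] (H ⊗[k] (H ⊗[k] (H ⊗[k] H))) →ₗ[k] H :=
  (LinearMap.mul' k H) ∘ₗ lTensor H ((LinearMap.mul' k H) ∘ₗ
    lTensor H ((LinearMap.mul' k H) ∘ₗ lTensor H (LinearMap.mul' k H)))

/-- The right-hand side of the L-R-smash product multiplication formula:
`(φ⊗h)(φ'⊗h') = (x¹·φ·z³h'₂y²)(x²h₁z¹·φ'·y³) ⊗ x³h₂z²h'₁y¹`,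
where `x`, `y`, `z` are three copies of `Φ⁻¹`. -/
def smashRHS (φ φ' : A) (h h' : H) : A ⊗[k] H :=
  let G : ((H ⊗[k] H) ⊗[k] (H ⊗[k] H)) ⊗[k] (H ⊗[k] H) :=
    zip3 (((osa ∘ₗ cc) Φinv) ⊗ₜ ((cc ∘ₗ (aso : (H ⊗[k] H) ⊗[k] H →ₗ[k] H ⊗[k] (H ⊗[k] H))) Φinv))
  let s2 : ((H ⊗[k] (H ⊗[k] H)) ⊗[k] (H ⊗[k] H)) ⊗[k] (H ⊗[k] (H ⊗[k] H)) :=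
    TensorProduct.map ins1 lc (tt ((cc (Δ.toLinearMap h')) ⊗ₜ G))
  let s4 : ((H ⊗[k] (H ⊗[k] H)) ⊗[k] ((H ⊗[k] H) ⊗[k] H)) ⊗[k] (H ⊗[k] (H ⊗[k] (H ⊗[k] H))) :=
    TensorProduct.map ins2 LinearMap.id (tt ((Δ.toLinearMap h) ⊗ₜ s2))
  let s5 : ((H ⊗[k] (H ⊗[k] (H ⊗[k] H))) ⊗[k] (H ⊗[k] ((H ⊗[k] H) ⊗[k] H))) ⊗[k]
      (H ⊗[k] (H ⊗[k] (H ⊗[k] (H ⊗[k] H)))) :=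
    rTensor (H ⊗[k] (H ⊗[k] (H ⊗[k] (H ⊗[k] H)))) tt (tt (Φinv ⊗ₜ s4))
  let s9 : (H ⊗[k] (H ⊗[k] (H ⊗[k] (H ⊗[k] H)))) ⊗[k] (A ⊗[k] A) :=
    lTensor (H ⊗[k] (H ⊗[k] (H ⊗[k] (H ⊗[k] H))))
      (TensorProduct.map (smashL actL actR) (smashR actL actR) ∘ₗ tt)
      (aso (rTensor (A ⊗[k] A) cc (s5 ⊗ₜ (φ ⊗ₜ φ'))))
  cc (TensorProduct.map smashF mulA s9)

end SmashRHS


section Separation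

variable {k : Type*} [Field k]

section Helpers

variable {M N P Q : Type*}
  [AddCommMonoid M] [AddCommMonoid N] [AddCommMonoid P] [AddCommMonoid Q]
  [Module k M] [Module k N] [Module k P] [Module k Q]

@[simp]
theorem aso_tmul (m : M) (n : N) (p : P) :
    aso (k := k) ((m ⊗ₜ n) ⊗ₜ p) = m ⊗ₜ (n ⊗ₜ p) := rfl

@[simp]
theorem osa_tmul (m : M) (n : N) (p : P) :
    osa (k := k) (m ⊗ₜ (n ⊗ₜ p)) = (m ⊗ₜ n) ⊗ₜ p := rfl

@[simp]
theorem cc_tmul (m : M) (n : N) : cc (k := k) (m ⊗ₜ n) = n ⊗ₜ m := rfl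

@[simp]
theorem lc_tmul (m : M) (n : N) (p : P) :
    lc (k := k) (m ⊗ₜ (n ⊗ₜ p)) = n ⊗ₜ (m ⊗ₜ p) := rfl

@[simp]
theorem tt_tmul (m : M) (n : N) (p : P) (q : Q) :
    tt (k := k) ((m ⊗ₜ n) ⊗ₜ (p ⊗ₜ q)) = (m ⊗ₜ p) ⊗ₜ (n ⊗ₜ q) := rfl

end Helpers

variable {H : Type*} [Ring H] [Algebra k H]
variable {A : Type*} [AddCommGroup A] [Module k A]
variable (actL : H ⊗[k] A →ₗ[k] A) (actR : A ⊗[k] H →ₗ[k] A)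
variable (mulA : A ⊗[k] A →ₗ[k] A)

/-- The right-hand side `smashRHS` with the three copies `x, y, z` of `Φ⁻¹` and the two
coproducts `Δ h = D`, `Δ h' = D'` treated as independent variables. -/
def smashRHSSep (x y z : (H ⊗[k] H) ⊗[k] H) (D D' : H ⊗[k] H) (φ φ' : A) : A ⊗[k] H :=
  let G : ((H ⊗[k] H) ⊗[k] (H ⊗[k] H)) ⊗[k] (H ⊗[k] H) :=
    zip3 (((osa ∘ₗ cc) z) ⊗ₜ ((cc ∘ₗ (aso : (H ⊗[k] H) ⊗[k] H →ₗ[k] H ⊗[k] (H ⊗[k] H))) y))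
  let s2 : ((H ⊗[k] (H ⊗[k] H)) ⊗[k] (H ⊗[k] H)) ⊗[k] (H ⊗[k] (H ⊗[k] H)) :=
    TensorProduct.map ins1 lc (tt ((cc D') ⊗ₜ G))
  let s4 : ((H ⊗[k] (H ⊗[k] H)) ⊗[k] ((H ⊗[k] H) ⊗[k] H)) ⊗[k] (H ⊗[k] (H ⊗[k] (H ⊗[k] H))) :=
    TensorProduct.map ins2 LinearMap.id (tt (D ⊗ₜ s2))
  let s5 : ((H ⊗[k] (H ⊗[k] (H ⊗[k] H))) ⊗[k] (H ⊗[k] ((H ⊗[k] H) ⊗[k] H))) ⊗[k]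
      (H ⊗[k] (H ⊗[k] (H ⊗[k] (H ⊗[k] H)))) :=
    rTensor (H ⊗[k] (H ⊗[k] (H ⊗[k] (H ⊗[k] H)))) tt (tt (x ⊗ₜ s4))
  let s9 : (H ⊗[k] (H ⊗[k] (H ⊗[k] (H ⊗[k] H)))) ⊗[k] (A ⊗[k] A) :=
    lTensor (H ⊗[k] (H ⊗[k] (H ⊗[k] (H ⊗[k] H))))
      (TensorProduct.map (smashL actL actR) (smashR actL actR) ∘ₗ tt)
      (aso (rTensor (A ⊗[k] A) cc (s5 ⊗ₜ (φ ⊗ₜ φ'))))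
  cc (TensorProduct.map smashF mulA s9)

/-- The L-R-crossed product multiplication agrees with `smashRHSSep` even when the three
copies of `Φ⁻¹` are replaced by arbitrary, unrelated tensors `x`, `y`, `z`. -/
theorem lrMul_eq_smashRHSSep
    (actL_actL : ∀ (h h' : H) (φ : A), actL (h ⊗ₜ actL (h' ⊗ₜ φ)) = actL ((h * h') ⊗ₜ φ))
    (actR_actR : ∀ (φ : A) (h h' : H), actR (actR (φ ⊗ₜ h) ⊗ₜ h') = actR (φ ⊗ₜ (h * h')))
    (actL_actR : ∀ (h : H) (φ : A) (h' : H),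
      actR (actL (h ⊗ₜ φ) ⊗ₜ h') = actL (h ⊗ₜ actR (φ ⊗ₜ h')))
    (Δ : H →ₐ[k] H ⊗[k] H) (x y z : (H ⊗[k] H) ⊗[k] H) (φ φ' : A) (h h' : H) :
    lrMul k (smashJ actL Δ) (smashT actR Δ) (smashγ actL actR z)
        (smashΛ actL actR mulA ∘ₗ TensorProduct.mk k _ (A ⊗[k] A) (x ⊗ₜ y))
        (φ ⊗ₜ h) (φ' ⊗ₜ h') =
      smashRHSSep actL actR mulA x y z (Δ h) (Δ h') φ φ' := by
  induction z with
  | zero => simp [lrMul, lrM, smashγ, smashRHSSep]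
  | add a b ha hb =>
    simp_all [lrMul, lrM, smashγ, smashRHSSep, add_tmul, tmul_add]
  | tmul z z₃ =>
  induction z with
  | zero => simp [lrMul, lrM, smashγ, smashRHSSep]
  | add a b ha hb =>
    simp_all [lrMul, lrM, smashγ, smashRHSSep, add_tmul, tmul_add]
  | tmul z₁ z₂ =>
  simp only [lrMul, lrM, smashγ, smashΓ, smashJ, smashT, smashRHSSep, LinearMap.comp_apply,
    TensorProduct.mk_apply, rTensor_tmul, lTensor_tmul, aso_tmul, osa_tmul, cc_tmul, lc_tmul,
    tt_tmul, AlgHom.toLinearMap_apply]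
  generalize Δ h = D
  induction D with
  | zero => simp
  | add a b ha hb => simp_all [add_tmul, tmul_add]
  | tmul h₁ h₂ =>
  simp only [rTensor_tmul, lTensor_tmul, aso_tmul, osa_tmul, cc_tmul]
  generalize Δ h' = D'
  induction D' with
  | zero => simp
  | add a b ha hb => simp_all [add_tmul, tmul_add]
  | tmul h₁' h₂' =>
  simp only [rTensor_tmul, osa_tmul, cc_tmul, tt_tmul, LinearMap.comp_apply,
    TensorProduct.mk_apply]
  induction x with
  | zero => simp
  | add a b ha hb => simp_all [add_tmul]
  | tmul x x₃ =>
  induction x with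
  | zero => simp
  | add a b ha hb => simp_all [add_tmul]
  | tmul x₁ x₂ =>
  induction y with
  | zero => simp
  | add a b ha hb => simp_all [add_tmul, tmul_add]
  | tmul y y₃ =>
  induction y with
  | zero => simp
  | add a b ha hb => simp_all [add_tmul, tmul_add]
  | tmul y₁ y₂ =>
  simp [smashΛ, smashΞ, smashSec, triAct, omegaM, zip3, ins1, ins2, smashL, smashR, smashF,
    actL_actL, actR_actR, actL_actR, mul_assoc]

end Separation


/-- Let `H` be a quasi-bialgebra and `A` an `H`-bimodule algebra, and let
`J`, `T`, `γ`, `η` be as in the L-R-smash product construction. Then the L-R-crossed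
product multiplication on `A ⊗ H` built from these maps equals the L-R-smash product
multiplication `(φ⊗h)(φ'⊗h') = (x¹·φ·z³h'₂y²)(x²h₁z¹·φ'·y³) ⊗ x³h₂z²h'₁y¹`. -/
theorem lr_crossed_product_eq_lr_smash_mul
    {k : Type*} [Field k] {H : Type*} [Ring H] [Algebra k H]
    {A : Type*} [AddCommGroup A] [Module k A]
    (Δ : H →ₐ[k] H ⊗[k] H) (ε : H →ₐ[k] k) (Φ Φinv : (H ⊗[k] H) ⊗[k] H)
    (actL : H ⊗[k] A →ₗ[k] A) (actR : A ⊗[k] H →ₗ[k] A)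
    (mulA : A ⊗[k] A →ₗ[k] A) (oneA : A)
    (hqb : IsQuasiBialgebra Δ ε Φ Φinv)
    (hba : IsBimoduleAlgebra actL actR mulA Δ ε Φ Φinv oneA) :
    ∀ (φ φ' : A) (h h' : H),
      lrMul k (smashJ actL Δ) (smashT actR Δ) (smashγ actL actR Φinv)
          (smashη actL actR mulA Φinv) (φ ⊗ₜ h) (φ' ⊗ₜ h') =
        smashRHS actL actR mulA Δ Φinv φ φ' h h' := by
  intro φ φ' h h'
  exact lrMul_eq_smashRHSSep actL actR mulA hba.actL_actL hba.actR_actR hba.actL_actR Δ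
    Φinv Φinv Φinv φ φ' h h'
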